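/- arXiv:1101.2380 — 2 statements merged into one kernel-verified Lean document; each statement's English description precedes it below -/
import Mathlib

section
/- As κ → 0⁺, σ̃(κ) = c(κ)/κ has the expansion σ̃(κ) = 1/n − κ²/(n²(n+2)) + O(κ⁴). -/
open Real intervalIntegral Filter Asymptotics

/-- Taylor expansion at `κ = 0` of the exponentially tilted integral of a continuous weight. -/
theorem isBigO_integral_mul_exp_mul_cos_sub_sum {g : ℝ → ℝ} (hg : Continuous g) {k : ℕ}
    (hk : 0 < k) :
    (fun κ : ℝ => (∫ θ in (0:ℝ)..π, g θ * exp (κ * cos θ)) -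
      ∑ j ∈ Finset.range k, κ ^ j / (j.factorial : ℝ) * ∫ θ in (0:ℝ)..π, g θ * cos θ ^ j)
      =O[nhds 0] fun κ : ℝ => κ ^ k := by
  set C : ℝ := (k.succ : ℝ) / (k.factorial * k)
  refine IsBigO.of_bound (∫ θ in (0:ℝ)..π, |g θ| * C) ?_
  have hball : ∀ᶠ κ : ℝ in nhds 0, |κ| < 1 :=
    continuous_abs.continuousAt.eventually_lt continuousAt_const (by simp)
  filter_upwards [hball] with κ hκ
  have hsum : (∑ j ∈ Finset.range k, κ ^ j / (j.factorial : ℝ) *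
      ∫ θ in (0:ℝ)..π, g θ * cos θ ^ j) =
      ∫ θ in (0:ℝ)..π, ∑ j ∈ Finset.range k, κ ^ j / (j.factorial : ℝ) * (g θ * cos θ ^ j) := by
    rw [intervalIntegral.integral_finsetSum]
    · simp only [intervalIntegral.integral_const_mul]
    · intro j _
      exact Continuous.intervalIntegrable (by fun_prop) _ _
  rw [hsum, ← intervalIntegral.integral_sub
    (Continuous.intervalIntegrable (by fun_prop) _ _)
    (Continuous.intervalIntegrable (by fun_prop) _ _), ← intervalIntegral.integral_mul_const]
  refine intervalIntegral.norm_integral_le_of_norm_le pi_pos.le (.of_forall fun θ _ => ?_)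
    (Continuous.intervalIntegrable (by fun_prop) _ _)
  have hle : |κ * cos θ| ≤ |κ| := by
    rw [abs_mul]
    exact mul_le_of_le_one_right (abs_nonneg _) (abs_cos_le_one θ)
  have hexp := Real.exp_bound (hle.trans hκ.le) hk
  have hfactor : g θ * exp (κ * cos θ) -
      ∑ j ∈ Finset.range k, κ ^ j / (j.factorial : ℝ) * (g θ * cos θ ^ j) =
      g θ * (exp (κ * cos θ) - ∑ j ∈ Finset.range k, (κ * cos θ) ^ j / (j.factorial : ℝ)) := by
    rw [mul_sub, Finset.mul_sum]
    congr 1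
    exact Finset.sum_congr rfl fun j _ => by ring
  rw [hfactor, norm_mul, Real.norm_eq_abs, Real.norm_eq_abs, norm_pow, Real.norm_eq_abs, mul_assoc]
  gcongr
  refine hexp.trans ?_
  rw [mul_comm]
  gcongr

theorem integral_sin_pow_mul_cos_pow_odd_zero_pi (m k : ℕ) :
    (∫ θ in (0:ℝ)..π, sin θ ^ m * cos θ ^ (2 * k + 1)) = 0 := by
  rw [integral_sin_pow_mul_cos_pow_odd]
  simp

theorem integral_sin_pow_add_two_zero_pi (m : ℕ) :
    (∫ θ in (0:ℝ)..π, sin θ ^ (m + 2)) =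
      ((m : ℝ) + 1) / (m + 2) * ∫ θ in (0:ℝ)..π, sin θ ^ m := by
  rw [integral_sin_pow]
  simp

theorem integral_sin_pow_mul_cos_sq_zero_pi (m : ℕ) :
    (∫ θ in (0:ℝ)..π, sin θ ^ m * cos θ ^ 2) =
      (∫ θ in (0:ℝ)..π, sin θ ^ m) / (m + 2) := by
  have hpoint : ∀ θ, sin θ ^ m * cos θ ^ 2 = sin θ ^ m - sin θ ^ (m + 2) := fun θ => by
    rw [cos_sq']; ring
  simp only [hpoint]
  rw [intervalIntegral.integral_sub (Continuous.intervalIntegrable (by fun_prop) _ _)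
    (Continuous.intervalIntegrable (by fun_prop) _ _), integral_sin_pow_add_two_zero_pi]
  field_simp
  ring

theorem integral_sin_pow_mul_cos_pow_four_zero_pi (m : ℕ) :
    (∫ θ in (0:ℝ)..π, sin θ ^ m * cos θ ^ 4) =
      3 * (∫ θ in (0:ℝ)..π, sin θ ^ m) / ((m + 2) * (m + 4)) := by
  have hpoint : ∀ θ, sin θ ^ m * cos θ ^ 4 =
      sin θ ^ m * cos θ ^ 2 - sin θ ^ (m + 2) * cos θ ^ 2 := fun θ => by
    linear_combination (sin θ ^ m * cos θ ^ 2) * sin_sq_add_cos_sq θ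
  simp only [hpoint]
  rw [intervalIntegral.integral_sub (Continuous.intervalIntegrable (by fun_prop) _ _)
    (Continuous.intervalIntegrable (by fun_prop) _ _), integral_sin_pow_mul_cos_sq_zero_pi,
    integral_sin_pow_mul_cos_sq_zero_pi, integral_sin_pow_add_two_zero_pi]
  push_cast
  have h : (m : ℝ) + 2 + 2 = m + 4 := by ring
  rw [h]
  field_simp
  ring

theorem isBigO_integral_exp_mul_cos_mul_sin_pow (m : ℕ) :
    (fun κ : ℝ => (∫ θ in (0:ℝ)..π, exp (κ * cos θ) * sin θ ^ m) -
      (∫ θ in (0:ℝ)..π, sin θ ^ m) * (1 + κ ^ 2 / (2 * (m + 2))))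
      =O[nhds 0] fun κ : ℝ => κ ^ 4 := by
  have h := isBigO_integral_mul_exp_mul_cos_sub_sum (g := fun θ => sin θ ^ m) (by fun_prop)
    (k := 4) (by norm_num)
  have h1 := integral_sin_pow_mul_cos_pow_odd_zero_pi m 0
  have h3 := integral_sin_pow_mul_cos_pow_odd_zero_pi m 1
  norm_num at h1 h3
  refine h.congr_left fun κ => ?_
  simp only [Finset.sum_range_succ, Finset.sum_range_zero, pow_zero, pow_one, mul_one, h1, h3,
    integral_sin_pow_mul_cos_sq_zero_pi, Nat.factorial, mul_comm (exp _)]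
  push_cast
  field_simp
  ring

theorem isBigO_integral_cos_mul_exp_mul_cos_mul_sin_pow (m : ℕ) :
    (fun κ : ℝ => (∫ θ in (0:ℝ)..π, cos θ * exp (κ * cos θ) * sin θ ^ m) -
      (∫ θ in (0:ℝ)..π, sin θ ^ m) *
        (κ / (m + 2) + κ ^ 3 / (2 * ((m + 2) * (m + 4)))))
      =O[nhds 0] fun κ : ℝ => κ ^ 5 := by
  have h := isBigO_integral_mul_exp_mul_cos_sub_sum (g := fun θ => sin θ ^ m * cos θ)
    (by fun_prop) (k := 5) (by norm_num)
  have h1 := integral_sin_pow_mul_cos_pow_odd_zero_pi m 0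
  have h3 := integral_sin_pow_mul_cos_pow_odd_zero_pi m 1
  have h5 := integral_sin_pow_mul_cos_pow_odd_zero_pi m 2
  norm_num at h1 h3 h5
  refine h.congr_left fun κ => ?_
  have hint : (∫ θ in (0:ℝ)..π, cos θ * exp (κ * cos θ) * sin θ ^ m) =
      ∫ θ in (0:ℝ)..π, sin θ ^ m * cos θ * exp (κ * cos θ) :=
    intervalIntegral.integral_congr fun θ _ => by ring
  rw [hint]
  simp only [mul_assoc, ← pow_succ', Finset.sum_range_succ, Finset.sum_range_zero, zero_add,
    pow_one, Nat.reduceAdd, h1, h3, h5, integral_sin_pow_mul_cos_sq_zero_pi,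
    integral_sin_pow_mul_cos_pow_four_zero_pi, Nat.factorial]
  generalize (∫ θ in (0:ℝ)..π, sin θ ^ m * (cos θ * exp (κ * cos θ))) = I
  push_cast
  field_simp
  ring

/-- As `κ → 0⁺`, `σ̃(κ) = c(κ)/κ` has the expansion
`σ̃(κ) = 1/n − κ²/(n²(n+2)) + O(κ⁴)`. -/
theorem stmt5 (n : ℕ) (hn : 2 ≤ n)
    (c : ℝ → ℝ)
    (hc : ∀ κ : ℝ, c κ =
      (∫ θ in (0:ℝ)..π, Real.cos θ * Real.exp (κ * Real.cos θ) * (Real.sin θ) ^ (n - 2)) /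
      (∫ θ in (0:ℝ)..π, Real.exp (κ * Real.cos θ) * (Real.sin θ) ^ (n - 2)))
    (σt : ℝ → ℝ) (hσt : ∀ κ : ℝ, σt κ = c κ / κ) :
    (fun κ : ℝ => σt κ - (1 / (n : ℝ) - κ ^ 2 / ((n : ℝ) ^ 2 * ((n : ℝ) + 2))))
      =O[nhdsWithin 0 (Set.Ioi 0)] fun κ : ℝ => κ ^ 4 := by
  obtain ⟨m, rfl⟩ := Nat.exists_eq_add_of_le' hn
  simp only [Nat.add_sub_cancel] at hc
  have hN := (isBigO_integral_cos_mul_exp_mul_cos_mul_sin_pow m).mono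
    (nhdsWithin_le_nhds (s := Set.Ioi 0))
  have hD₀ := isBigO_integral_exp_mul_cos_mul_sin_pow m
  set S : ℝ := ∫ θ in (0:ℝ)..π, sin θ ^ m
  have hS : 0 < S := integral_sin_pow_pos m
  set D : ℝ → ℝ := fun κ => ∫ θ in (0:ℝ)..π, exp (κ * cos θ) * sin θ ^ m
  set N : ℝ → ℝ := fun κ => ∫ θ in (0:ℝ)..π, cos θ * exp (κ * cos θ) * sin θ ^ m
  have hDlim : Tendsto D (nhds 0) (nhds S) := by
    have h4 : Tendsto (fun κ : ℝ => κ ^ 4) (nhds 0) (nhds 0) :=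
      (by fun_prop : Continuous fun κ : ℝ => κ ^ 4).tendsto' _ _ (by norm_num)
    have hmain : Tendsto (fun κ : ℝ => S * (1 + κ ^ 2 / (2 * (m + 2)))) (nhds 0) (nhds S) :=
      (by fun_prop : Continuous fun κ : ℝ => S * (1 + κ ^ 2 / (2 * ((m : ℝ) + 2)))).tendsto' _ _
        (by norm_num)
    simpa using (hD₀.trans_tendsto h4).add hmain
  have hDlim' : Tendsto D (nhdsWithin 0 (Set.Ioi 0)) (nhds S) :=
    hDlim.mono_left nhdsWithin_le_nhds
  have hDinv : (fun κ => (D κ)⁻¹) =O[nhdsWithin 0 (Set.Ioi 0)] fun _ => (1 : ℝ) :=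
    (hDlim'.inv₀ hS.ne').isBigO_one ℝ
  have hκ : ∀ᶠ κ : ℝ in nhdsWithin 0 (Set.Ioi 0), 0 < κ := self_mem_nhdsWithin
  set T : ℝ → ℝ := fun κ => 1 / ((m : ℝ) + 2) - κ ^ 2 / (((m : ℝ) + 2) ^ 2 * (m + 4)) with hT
  have hTO : T =O[nhdsWithin 0 (Set.Ioi 0)] fun _ => (1 : ℝ) :=
    ((by fun_prop : Continuous T).tendsto 0).mono_left nhdsWithin_le_nhds |>.isBigO_one ℝ
  have hNκ : (fun κ => (N κ - S * (κ / (m + 2) + κ ^ 3 / (2 * ((m + 2) * (m + 4))))) * κ⁻¹)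
      =O[nhdsWithin 0 (Set.Ioi 0)] fun κ : ℝ => κ ^ 4 := by
    refine (hN.mul (isBigO_refl (fun κ : ℝ => κ⁻¹) _)).congr' EventuallyEq.rfl ?_
    filter_upwards [hκ] with κ hκ
    field_simp
  have hDT := (hD₀.mono (nhdsWithin_le_nhds (s := Set.Ioi 0))).mul hTO
  have hrem : (fun κ : ℝ => S / (2 * ((m : ℝ) + 2) ^ 3 * (m + 4)) * κ ^ 4)
      =O[nhdsWithin 0 (Set.Ioi 0)] fun κ : ℝ => κ ^ 4 := isBigO_const_mul_self _ _ _
  simp only [mul_one] at hDT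
  refine (((hNκ.sub hDT).add hrem).mul hDinv).congr' ?_ (by simp)
  filter_upwards [hκ, hDlim'.eventually_ne hS.ne'] with κ hκ hDκ
  have hcκ : c κ = N κ / D κ := hc κ
  have hcast : ((m + 2 : ℕ) : ℝ) = m + 2 := by push_cast; rfl
  have h4 : (m : ℝ) + 2 + 2 = m + 4 := by ring
  rw [hσt, hcκ, hcast, h4, hT]
  change ((N κ - _) * _ - (D κ - _) * _ + _) * _ = _
  generalize D κ = d at *
  generalize N κ = ν at *
  field_simp
  ring
end

section
/- The dissipation D(f) = ∫_S f|∇_ω(σ ln f − ω·J[f])|²dω of a smooth positive probability density f admits the expansion D(f) = σ²∫_S |∇f|²/f + (1 − 2(n−1)σ)|J[f]|² − ∫_S (ω·J[f])² f dω. -/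
open MeasureTheory Real intervalIntegral
open scoped RealInnerProductSpace BigOperators

noncomputable section

/-- The tangential (spherical) gradient of a function on `ℝⁿ`, at points of the unit
sphere: the orthogonal projection of the full gradient onto the tangent space. -/
def gradS {n : ℕ} (g : EuclideanSpace ℝ (Fin n) → ℝ) (x : EuclideanSpace ℝ (Fin n)) :
    EuclideanSpace ℝ (Fin n) :=
  gradient g x - ⟪gradient g x, x⟫ • x

/-- The tangential (spherical) divergence of a vector field, at points of the unit
sphere: the trace of the derivative composed with the tangential projection. -/
def divS {n : ℕ} (A : EuclideanSpace ℝ (Fin n) → EuclideanSpace ℝ (Fin n))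
    (x : EuclideanSpace ℝ (Fin n)) : ℝ :=
  (∑ i : Fin n, ⟪fderiv ℝ A x (EuclideanSpace.single i 1), EuclideanSpace.single i 1⟫)
    - ⟪fderiv ℝ A x x, x⟫

/-- The Laplace–Beltrami operator on the unit sphere. -/
def lapS {n : ℕ} (g : EuclideanSpace ℝ (Fin n) → ℝ) (x : EuclideanSpace ℝ (Fin n)) : ℝ :=
  divS (gradS g) x

/-- A measure `μ` on the unit sphere of `ℝⁿ` is the uniform probability measure if it is a
rotation-invariant probability measure. -/
def IsUniformProb {n : ℕ} (μ : Measure (Metric.sphere (0 : EuclideanSpace ℝ (Fin n)) 1)) :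
    Prop :=
  IsProbabilityMeasure μ ∧
    ∀ T : EuclideanSpace ℝ (Fin n) ≃ₗᵢ[ℝ] EuclideanSpace ℝ (Fin n),
      Measure.map (fun ω : Metric.sphere (0 : EuclideanSpace ℝ (Fin n)) 1 =>
        (⟨T ω, by
          rw [mem_sphere_zero_iff_norm, T.norm_map]
          exact mem_sphere_zero_iff_norm.mp ω.2⟩ :
          Metric.sphere (0 : EuclideanSpace ℝ (Fin n)) 1)) μ = μ

/-- The momentum (flux) `J[f] = ∫_S ω f(ω) dω` of a density on the unit sphere. -/
def Jflux {n : ℕ} (μ : Measure (Metric.sphere (0 : EuclideanSpace ℝ (Fin n)) 1))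
    (f : EuclideanSpace ℝ (Fin n) → ℝ) : EuclideanSpace ℝ (Fin n) :=
  ∫ ω : Metric.sphere (0 : EuclideanSpace ℝ (Fin n)) 1, f ω • (ω : EuclideanSpace ℝ (Fin n)) ∂μ

theorem integrable_sphere {n : ℕ} (μ : Measure (Metric.sphere (0 : EuclideanSpace ℝ (Fin n)) 1))
    [IsProbabilityMeasure μ] {F : Type*} [NormedAddCommGroup F]
    {h : Metric.sphere (0 : EuclideanSpace ℝ (Fin n)) 1 → F} (hh : Continuous h) :
    Integrable h μ :=
  hh.integrable_of_hasCompactSupport (HasCompactSupport.of_compactSpace h)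

theorem IsUniformProb.integral_comp_isometry {n : ℕ}
    {μ : Measure (Metric.sphere (0 : EuclideanSpace ℝ (Fin n)) 1)} (hμ : IsUniformProb μ)
    (T : EuclideanSpace ℝ (Fin n) ≃ₗᵢ[ℝ] EuclideanSpace ℝ (Fin n))
    {h : EuclideanSpace ℝ (Fin n) → ℝ} (hh : Continuous h) :
    ∫ ω, h (T (ω : EuclideanSpace ℝ (Fin n))) ∂μ = ∫ ω, h (ω : EuclideanSpace ℝ (Fin n)) ∂μ := by
  conv_rhs => rw [← hμ.2 T]
  have hc : Continuous (fun ω : Metric.sphere (0 : EuclideanSpace ℝ (Fin n)) 1 =>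
      h (ω : EuclideanSpace ℝ (Fin n))) := hh.comp continuous_subtype_val
  rw [integral_map _ hc.aestronglyMeasurable]
  refine Continuous.aemeasurable ?_
  exact (T.continuous.comp continuous_subtype_val).subtype_mk _

/-- The integral over the sphere of the derivative of a function along an infinitesimal
rotation vanishes. -/
theorem IsUniformProb.integral_fderiv_skewAdjoint {n : ℕ}
    {μ : Measure (Metric.sphere (0 : EuclideanSpace ℝ (Fin n)) 1)} (hμ : IsUniformProb μ)
    {A : EuclideanSpace ℝ (Fin n) →L[ℝ] EuclideanSpace ℝ (Fin n)}
    (hA : A ∈ skewAdjoint (EuclideanSpace ℝ (Fin n) →L[ℝ] EuclideanSpace ℝ (Fin n)))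
    {g : EuclideanSpace ℝ (Fin n) → ℝ} (hg : ContDiff ℝ 1 g) :
    ∫ ω : Metric.sphere (0 : EuclideanSpace ℝ (Fin n)) 1,
      fderiv ℝ g ω (A (ω : EuclideanSpace ℝ (Fin n))) ∂μ = 0 := by
  have := hμ.1
  let +nondep : NormedAlgebra ℚ (EuclideanSpace ℝ (Fin n) →L[ℝ] EuclideanSpace ℝ (Fin n)) :=
    .restrictScalars ℚ ℝ _
  let U : ℝ → EuclideanSpace ℝ (Fin n) →L[ℝ] EuclideanSpace ℝ (Fin n) :=
    fun t => NormedSpace.exp (t • A)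
  have hU (t : ℝ) : U t ∈ unitary (EuclideanSpace ℝ (Fin n) →L[ℝ] EuclideanSpace ℝ (Fin n)) :=
    NormedSpace.exp_mem_unitary_of_mem_skewAdjoint (skewAdjoint.smul_mem t hA)
  have hU_sphere (t : ℝ) {x : EuclideanSpace ℝ (Fin n)}
      (hx : x ∈ Metric.sphere (0 : EuclideanSpace ℝ (Fin n)) 1) :
      U t x ∈ Metric.sphere (0 : EuclideanSpace ℝ (Fin n)) 1 := by
    rw [mem_sphere_zero_iff_norm, (U t).norm_map_of_mem_unitary (hU t)]
    exact mem_sphere_zero_iff_norm.mp hx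
  have hU_zero : U 0 = 1 := by
    have h0 : (0 : ℝ) • A = 0 := zero_smul ℝ A
    simp only [U, h0, NormedSpace.exp_zero]
  have hU_deriv (t : ℝ) (x : EuclideanSpace ℝ (Fin n)) :
      HasDerivAt (fun s => U s x) (A (U t x)) t := by
    have := (hasDerivAt_exp_smul_const' A t).clm_apply (hasDerivAt_const t x)
    simpa [U] using this
  have hDg : Continuous fun x => fderiv ℝ g x (A x) :=
    (hg.continuous_fderiv one_ne_zero).clm_apply A.continuous
  obtain ⟨C, hC⟩ := (isCompact_sphere (0 : EuclideanSpace ℝ (Fin n)) 1).exists_bound_of_continuousOn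
    hDg.continuousOn
  have hcont (t : ℝ) : Continuous fun ω : Metric.sphere (0 : EuclideanSpace ℝ (Fin n)) 1 =>
      U t (ω : EuclideanSpace ℝ (Fin n)) := (U t).continuous.comp continuous_subtype_val
  have hderiv := (hasDerivAt_integral_of_dominated_loc_of_deriv_le (μ := μ) (s := Set.univ)
    (x₀ := (0 : ℝ)) (bound := fun _ => C)
    (F := fun t (ω : Metric.sphere (0 : EuclideanSpace ℝ (Fin n)) 1) => g (U t ω))
    (F' := fun t (ω : Metric.sphere (0 : EuclideanSpace ℝ (Fin n)) 1) =>
      fderiv ℝ g (U t ω) (A (U t ω)))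
    Filter.univ_mem
    (.of_forall fun t => (hg.continuous.comp (hcont t)).aestronglyMeasurable)
    (integrable_sphere μ (hg.continuous.comp (hcont 0)))
    (hDg.comp (hcont 0)).aestronglyMeasurable
    (.of_forall fun ω t _ => hC _ (hU_sphere t ω.2))
    (integrable_const C)
    (.of_forall fun ω t _ => ((hg.differentiable one_ne_zero _).hasFDerivAt.comp_hasDerivAt t
      (hU_deriv t ω)))).2
  have hconst : (fun t => ∫ ω : Metric.sphere (0 : EuclideanSpace ℝ (Fin n)) 1, g (U t ω) ∂μ)
      = fun _ => ∫ ω : Metric.sphere (0 : EuclideanSpace ℝ (Fin n)) 1, g ω ∂μ := by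
    funext t
    exact hμ.integral_comp_isometry (Unitary.linearIsometryEquiv ⟨U t, hU t⟩) hg.continuous
  rw [hconst] at hderiv
  simpa [hU_zero] using hderiv.unique (hasDerivAt_const _ _)

/-- The generator `x ↦ ⟪a, x⟫ b - ⟪b, x⟫ a` of the rotations in the plane spanned by `a`, `b`. -/
def planeRotation {n : ℕ} (a b : EuclideanSpace ℝ (Fin n)) :
    EuclideanSpace ℝ (Fin n) →L[ℝ] EuclideanSpace ℝ (Fin n) :=
  (innerSL ℝ a).smulRight b - (innerSL ℝ b).smulRight a

theorem planeRotation_apply {n : ℕ} (a b x : EuclideanSpace ℝ (Fin n)) :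
    planeRotation a b x = ⟪a, x⟫ • b - ⟪b, x⟫ • a := by
  simp [planeRotation]

theorem planeRotation_mem_skewAdjoint {n : ℕ} (a b : EuclideanSpace ℝ (Fin n)) :
    planeRotation a b ∈
      skewAdjoint (EuclideanSpace ℝ (Fin n) →L[ℝ] EuclideanSpace ℝ (Fin n)) := by
  rw [skewAdjoint.mem_iff, ContinuousLinearMap.star_eq_adjoint]
  refine ContinuousLinearMap.ext fun x => ext_inner_right ℝ fun y => ?_
  rw [ContinuousLinearMap.adjoint_inner_left, neg_apply, planeRotation_apply,
    planeRotation_apply]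
  simp only [inner_sub_left, inner_sub_right, inner_neg_left, inner_smul_left, inner_smul_right,
    real_inner_comm x, conj_trivial]
  ring

/-- Integration by parts on the sphere against the tangential gradient of a linear form. -/
theorem IsUniformProb.integral_fderiv_tangential {n : ℕ}
    {μ : Measure (Metric.sphere (0 : EuclideanSpace ℝ (Fin n)) 1)} (hμ : IsUniformProb μ)
    {f : EuclideanSpace ℝ (Fin n) → ℝ} (hf : ContDiff ℝ 1 f) (V : EuclideanSpace ℝ (Fin n)) :
    ∫ ω : Metric.sphere (0 : EuclideanSpace ℝ (Fin n)) 1,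
        fderiv ℝ f ω (V - ⟪V, (ω : EuclideanSpace ℝ (Fin n))⟫ • (ω : EuclideanSpace ℝ (Fin n))) ∂μ
      = ((n : ℝ) - 1) * ∫ ω : Metric.sphere (0 : EuclideanSpace ℝ (Fin n)) 1,
        f ω * ⟪V, (ω : EuclideanSpace ℝ (Fin n))⟫ ∂μ := by
  have := hμ.1
  let e : Fin n → EuclideanSpace ℝ (Fin n) := fun i => EuclideanSpace.single i 1
  let g : Fin n → EuclideanSpace ℝ (Fin n) → ℝ := fun i x => ⟪e i, x⟫ * f x
  have hg (i : Fin n) : ContDiff ℝ 1 (g i) := (contDiff_const.inner ℝ contDiff_id).mul hf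
  have hzero (i : Fin n) := hμ.integral_fderiv_skewAdjoint
    (planeRotation_mem_skewAdjoint (e i) V) (hg i)
  have hint (i : Fin n) : Integrable (fun ω : Metric.sphere (0 : EuclideanSpace ℝ (Fin n)) 1 =>
      fderiv ℝ (g i) ω (planeRotation (e i) V ω)) μ :=
    integrable_sphere μ ((((hg i).continuous_fderiv one_ne_zero).clm_apply
      (planeRotation (e i) V).continuous).comp continuous_subtype_val)
  have hsum (x : EuclideanSpace ℝ (Fin n)) (hx : ‖x‖ = 1) :
      fderiv ℝ f x (V - ⟪V, x⟫ • x)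
        = (∑ i, fderiv ℝ (g i) x (planeRotation (e i) V x)) + ((n : ℝ) - 1) * (f x * ⟪V, x⟫) := by
    have hd (i : Fin n) (v : EuclideanSpace ℝ (Fin n)) :
        fderiv ℝ (g i) x v = x i * fderiv ℝ f x v + f x * v i := by
      have h1 : HasFDerivAt (fun y => ⟪e i, y⟫) (innerSL ℝ (e i)) x :=
        (innerSL ℝ (e i)).hasFDerivAt
      have h2 := h1.mul (hf.differentiable one_ne_zero x).hasFDerivAt
      rw [show fderiv ℝ (g i) x = _ from h2.fderiv]
      simp [e, EuclideanSpace.inner_single_left]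
    have hx2 : ∑ i, x i * x i = 1 := by
      have := EuclideanSpace.real_norm_sq_eq x
      rw [hx] at this
      simpa [pow_two] using this.symm
    have hxs : ∑ i, x i • e i = x := by
      simpa [e] using (EuclideanSpace.basisFun (Fin n) ℝ).sum_repr x
    have hVx : ∑ i, x i * V i = ⟪V, x⟫ := by
      simp [PiLp.inner_apply]
    have hrot (i : Fin n) : planeRotation (e i) V x = x i • V - ⟪V, x⟫ • e i := by
      simp [planeRotation_apply, e, EuclideanSpace.inner_single_left]
    have hlin : ∑ i, x i * fderiv ℝ f x (e i) = fderiv ℝ f x x := by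
      simpa only [map_sum, map_smul, smul_eq_mul] using congrArg (fderiv ℝ f x) hxs
    have hei (i : Fin n) : e i i = 1 := by simp [e]
    simp only [hd, hrot, map_sub, map_smul, smul_eq_mul, PiLp.sub_apply, PiLp.smul_apply, hei]
    calc fderiv ℝ f x V - ⟪V, x⟫ * fderiv ℝ f x x
        = (∑ i, x i * x i) * fderiv ℝ f x V - ⟪V, x⟫ * ∑ i, x i * fderiv ℝ f x (e i)
          + f x * (∑ i, x i * V i - ∑ _i : Fin n, ⟪V, x⟫) + ((n : ℝ) - 1) * (f x * ⟪V, x⟫) := by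
          rw [hx2, hlin, hVx]
          simp only [Finset.sum_const, Finset.card_univ, Fintype.card_fin, nsmul_eq_mul]
          ring
      _ = _ := by
          rw [← Finset.sum_sub_distrib, Finset.sum_mul, Finset.mul_sum, Finset.mul_sum,
            ← Finset.sum_sub_distrib, ← Finset.sum_add_distrib]
          congr 1
          refine Finset.sum_congr rfl fun i _ => ?_
          ring
  rw [MeasureTheory.integral_congr_ae (.of_forall fun ω : Metric.sphere (0 : EuclideanSpace ℝ (Fin n)) 1 =>
      hsum ω (mem_sphere_zero_iff_norm.mp ω.2)),
    MeasureTheory.integral_add (integrable_finsetSum _ fun i _ => hint i), MeasureTheory.integral_finsetSum _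
      fun i _ => hint i, MeasureTheory.integral_const_mul]
  · simp [hzero]
  · refine integrable_sphere μ (continuous_const.mul ?_)
    exact (hf.continuous.mul (continuous_const.inner continuous_id)).comp continuous_subtype_val

theorem norm_sq_sub_inner_smul {E : Type*} [NormedAddCommGroup E] [InnerProductSpace ℝ E]
    (v : E) {x : E} (hx : ‖x‖ = 1) : ‖v - ⟪v, x⟫ • x‖ ^ 2 = ‖v‖ ^ 2 - ⟪v, x⟫ ^ 2 := by
  rw [norm_sub_sq_real, norm_smul, hx, inner_smul_right, mul_one, Real.norm_eq_abs, sq_abs]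
  ring

theorem gradS_log_sub_inner {n : ℕ} {f : EuclideanSpace ℝ (Fin n) → ℝ}
    {x : EuclideanSpace ℝ (Fin n)} (hf : DifferentiableAt ℝ f x) (hx : f x ≠ 0) (σ : ℝ)
    (V : EuclideanSpace ℝ (Fin n)) :
    gradS (fun y => σ * Real.log (f y) - ⟪y, V⟫) x
      = (σ / f x) • gradS f x - (V - ⟪V, x⟫ • x) := by
  have hgrad : gradient (fun y => σ * Real.log (f y) - ⟪y, V⟫) x
      = (σ / f x) • gradient f x - V := by
    refine HasGradientAt.gradient (hasGradientAt_iff_hasFDerivAt.2 ?_)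
    have h1 : HasFDerivAt (fun y => ⟪y, V⟫) (innerSL ℝ V) x := by
      simpa [real_inner_comm] using (innerSL ℝ V).hasFDerivAt (x := x)
    refine (((hf.hasFDerivAt.log hx).const_mul σ).sub h1).congr_fderiv ?_
    ext v
    simp [div_eq_mul_inv, mul_assoc]
  simp only [gradS, hgrad, inner_sub_left, inner_smul_left, conj_trivial, smul_sub, sub_smul,
    mul_smul]
  abel

theorem mul_norm_sq_gradS_log_sub_inner {n : ℕ} {f : EuclideanSpace ℝ (Fin n) → ℝ}
    {x : EuclideanSpace ℝ (Fin n)} (hf : DifferentiableAt ℝ f x) (hfx : f x ≠ 0) (hx : ‖x‖ = 1)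
    (σ : ℝ) (V : EuclideanSpace ℝ (Fin n)) :
    f x * ‖gradS (fun y => σ * Real.log (f y) - ⟪y, V⟫) x‖ ^ 2
      = σ ^ 2 * (‖gradS f x‖ ^ 2 / f x) - 2 * σ * fderiv ℝ f x (V - ⟪V, x⟫ • x)
        + ‖V‖ ^ 2 * f x - ⟪x, V⟫ ^ 2 * f x := by
  have hinner : ⟪gradS f x, V - ⟪V, x⟫ • x⟫ = fderiv ℝ f x (V - ⟪V, x⟫ • x) := by
    have hxV : ⟪x, V - ⟪V, x⟫ • x⟫ = 0 := by
      rw [inner_sub_right, inner_smul_right, real_inner_self_eq_norm_sq, hx, real_inner_comm]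
      ring
    rw [gradS, inner_sub_left, real_inner_smul_left, hxV, inner_gradient_left, mul_zero, sub_zero]
  rw [gradS_log_sub_inner hf hfx, norm_sub_sq_real, real_inner_smul_left, hinner,
    norm_sq_sub_inner_smul V hx, norm_smul, mul_pow, Real.norm_eq_abs, sq_abs, real_inner_comm V x]
  field_simp
  ring

/-- Expansion of the entropy dissipation: for a smooth positive probability density `f`,
`D(f) = σ²∫ |∇f|²/f + (1 − 2(n−1)σ)|J[f]|² − ∫ (ω·J[f])² f dω`. -/
theorem stmt16 (n : ℕ) (hn : 2 ≤ n) (σ : ℝ) (hσ : 0 < σ)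
    (μ : Measure (Metric.sphere (0 : EuclideanSpace ℝ (Fin n)) 1)) (hμ : IsUniformProb μ)
    (f : EuclideanSpace ℝ (Fin n) → ℝ) (hreg : ContDiff ℝ (⊤ : ℕ∞) f)
    (hpos : ∀ ω ∈ Metric.sphere (0 : EuclideanSpace ℝ (Fin n)) 1, 0 < f ω)
    (hprob : ∫ ω : Metric.sphere (0 : EuclideanSpace ℝ (Fin n)) 1, f ω ∂μ = 1) :
    (∫ ω : Metric.sphere (0 : EuclideanSpace ℝ (Fin n)) 1,
        f ω * ‖gradS (fun y => σ * Real.log (f y) - ⟪y, Jflux μ f⟫)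
          (ω : EuclideanSpace ℝ (Fin n))‖ ^ 2 ∂μ)
      = σ ^ 2 * (∫ ω : Metric.sphere (0 : EuclideanSpace ℝ (Fin n)) 1,
          ‖gradS f (ω : EuclideanSpace ℝ (Fin n))‖ ^ 2 / f ω ∂μ)
        + (1 - 2 * ((n : ℝ) - 1) * σ) * ‖Jflux μ f‖ ^ 2
        - ∫ ω : Metric.sphere (0 : EuclideanSpace ℝ (Fin n)) 1,
            ⟪(ω : EuclideanSpace ℝ (Fin n)), Jflux μ f⟫ ^ 2 * f ω ∂μ := by
  have := hμ.1
  have hf1 : ContDiff ℝ 1 f := hreg.of_le (by exact_mod_cast le_top)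
  have hfc : Continuous fun ω : Metric.sphere (0 : EuclideanSpace ℝ (Fin n)) 1 =>
      f (ω : EuclideanSpace ℝ (Fin n)) := hf1.continuous.comp continuous_subtype_val
  set V := Jflux μ f
  have hflux : ∫ ω : Metric.sphere (0 : EuclideanSpace ℝ (Fin n)) 1,
      f ω * ⟪V, (ω : EuclideanSpace ℝ (Fin n))⟫ ∂μ = ‖V‖ ^ 2 := by
    simp only [← real_inner_smul_right]
    rw [integral_inner (integrable_sphere μ (h := fun ω => f ω • (ω : EuclideanSpace ℝ (Fin n)))
      (hfc.smul continuous_subtype_val)),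
      ← real_inner_self_eq_norm_sq]
    rfl
  have hDf := hf1.continuous_fderiv one_ne_zero
  have hgradS : Continuous (gradS f) := by
    have hgrad : Continuous (gradient f) :=
      (InnerProductSpace.toDual ℝ (EuclideanSpace ℝ (Fin n))).symm.continuous.comp hDf
    unfold gradS
    fun_prop
  have hI1 : Integrable (fun ω : Metric.sphere (0 : EuclideanSpace ℝ (Fin n)) 1 =>
      σ ^ 2 * (‖gradS f (ω : EuclideanSpace ℝ (Fin n))‖ ^ 2 / f ω)) μ :=
    integrable_sphere μ (continuous_const.mul
      (((hgradS.comp continuous_subtype_val).norm.pow 2).div hfc fun ω => (hpos ω ω.2).ne'))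
  have hI2 : Integrable (fun ω : Metric.sphere (0 : EuclideanSpace ℝ (Fin n)) 1 =>
      2 * σ * fderiv ℝ f ω
        (V - ⟪V, (ω : EuclideanSpace ℝ (Fin n))⟫ • (ω : EuclideanSpace ℝ (Fin n)))) μ :=
    integrable_sphere μ (by fun_prop)
  have hI3 : Integrable (fun ω : Metric.sphere (0 : EuclideanSpace ℝ (Fin n)) 1 =>
      ‖V‖ ^ 2 * f ω) μ := integrable_sphere μ (continuous_const.mul hfc)
  have hI4 : Integrable (fun ω : Metric.sphere (0 : EuclideanSpace ℝ (Fin n)) 1 =>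
      ⟪(ω : EuclideanSpace ℝ (Fin n)), V⟫ ^ 2 * f ω) μ :=
    integrable_sphere μ (((continuous_subtype_val.inner continuous_const).pow 2).mul hfc)
  rw [MeasureTheory.integral_congr_ae (.of_forall fun ω : Metric.sphere
      (0 : EuclideanSpace ℝ (Fin n)) 1 => mul_norm_sq_gradS_log_sub_inner
      (hf1.differentiable one_ne_zero ω) (hpos ω ω.2).ne' (mem_sphere_zero_iff_norm.mp ω.2) σ V),
    MeasureTheory.integral_sub ((hI1.sub' hI2).fun_add hI3) hI4, MeasureTheory.integral_add (hI1.sub' hI2) hI3,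
    MeasureTheory.integral_sub hI1 hI2, MeasureTheory.integral_const_mul,
    MeasureTheory.integral_const_mul, MeasureTheory.integral_const_mul,
    hμ.integral_fderiv_tangential hf1, hflux, hprob]
  ring
end
end
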